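/- For each p ∈ (0,1), the function λ ↦ d_tv(X_{1,p}, Π_λ) is strictly increasing in λ on the interval [λ*_p, ∞), where λ*_p := min(-ln(1-p), 1). -/

import Mathlib

/-- The Bernoulli(p) probability mass function on ℕ. -/
noncomputable def bernoulliPMF (p : ℝ) : ℕ → ℝ :=
  fun k => if k = 0 then 1 - p else if k = 1 then p else 0

/-- The Poisson(l) probability mass function on ℕ. -/
noncomputable def poissonPMF (l : ℝ) : ℕ → ℝ :=
  fun k => Real.exp (-l) * l ^ k / (Nat.factorial k)

/-- Total variation distance between two distributions on ℕ. -/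
noncomputable def dtv (P Q : ℕ → ℝ) : ℝ := (1 / 2) * ∑' k : ℕ, |P k - Q k|

theorem hasSum_poissonPMF (l : ℝ) : HasSum (poissonPMF l) 1 := by
  have h := (NormedSpace.expSeries_div_hasSum_exp l).mul_left (Real.exp (-l))
  rw [← Real.exp_eq_exp_ℝ, ← Real.exp_add, neg_add_cancel, Real.exp_zero] at h
  refine h.congr_fun fun k => ?_
  simp only [poissonPMF, mul_div_assoc]

/-- The total variation distance is the sum of the positive parts of the differences of the
probability mass functions at `0` and `1`. -/
theorem dtv_bernoulliPMF_poissonPMF (p : ℝ) {l : ℝ} (hl : 0 ≤ l) :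
    dtv (bernoulliPMF p) (poissonPMF l) =
      max (1 - p - Real.exp (-l)) 0 + max (p - l * Real.exp (-l)) 0 := by
  have hg : HasSum (fun k => |bernoulliPMF p k - poissonPMF l k| - poissonPMF l k)
      (∑ k ∈ Finset.range 2, (|bernoulliPMF p k - poissonPMF l k| - poissonPMF l k)) := by
    refine hasSum_sum_of_ne_finset_zero fun k hk => ?_
    have hk : 2 ≤ k := by simpa [Nat.succ_le_iff] using hk
    have h0 : 0 ≤ poissonPMF l k := by unfold poissonPMF; positivity
    have hb : bernoulliPMF p k = 0 := by
      simp [bernoulliPMF, show k ≠ 0 by omega, show k ≠ 1 by omega]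
    rw [hb, zero_sub, abs_neg, abs_of_nonneg h0, sub_self]
  have h := hg.add (hasSum_poissonPMF l)
  simp only [sub_add_cancel] at h
  rw [dtv, h.tsum_eq]
  simp only [Finset.sum_range_succ, Finset.sum_range_zero, bernoulliPMF, poissonPMF]
  simp only [if_true, one_ne_zero, if_false, pow_zero, pow_one, Nat.factorial, Nat.cast_one,
    mul_one, div_one, zero_add, mul_comm (Real.exp (-l)) l]
  have hmax (a : ℝ) : max a 0 = (a + |a|) / 2 := by
    rcases le_total a 0 with h | h
    · rw [max_eq_right h, abs_of_nonpos h]; ring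
    · rw [max_eq_left h, abs_of_nonneg h]; ring
  rw [hmax, hmax]
  ring

theorem stmt_2 (p : ℝ) (hp : p ∈ Set.Ioo (0 : ℝ) 1) :
    StrictMonoOn (fun l : ℝ => dtv (bernoulliPMF p) (poissonPMF l))
      (Set.Ici (min (-Real.log (1 - p)) 1)) := by
  obtain ⟨hp0, hp1⟩ := hp
  have hlog : 0 < -Real.log (1 - p) :=
    neg_pos.mpr (Real.log_neg (by linarith) (by linarith))
  intro x hx y _ hxy
  have hx0 : 0 < x := (lt_min hlog one_pos).trans_le hx
  simp only [dtv_bernoulliPMF_poissonPMF p hx0.le,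
    dtv_bernoulliPMF_poissonPMF p (hx0.trans hxy).le]
  have hE : Real.exp (-x) = Real.exp (y - x) * Real.exp (-y) := by
    rw [← Real.exp_add]; ring_nf
  have hd : y - x + 1 < Real.exp (y - x) := Real.add_one_lt_exp (by linarith)
  have hexp : Real.exp (-y) < Real.exp (-x) := Real.exp_lt_exp.mpr (by linarith)
  have hy := Real.exp_pos (-y)
  have hmul : (1 + y) * Real.exp (-y) < (1 + x) * Real.exp (-x) := by
    rw [hE, ← mul_assoc]
    exact mul_lt_mul_of_pos_right (by nlinarith) hy
  rcases le_or_gt (-Real.log (1 - p)) x with hL | hL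
  · have hA : Real.exp (-x) ≤ 1 - p := by
      rw [← Real.exp_log (show 0 < 1 - p by linarith)]
      exact Real.exp_le_exp.mpr (by linarith)
    rw [max_eq_left (by linarith : 0 ≤ 1 - p - Real.exp (-x)),
      max_eq_left (by linarith : 0 ≤ 1 - p - Real.exp (-y))]
    rcases max_cases (p - x * Real.exp (-x)) 0 with h | h <;>
      linarith [le_max_left (p - y * Real.exp (-y)) 0, le_max_right (p - y * Real.exp (-y)) 0]
  · have hx1 : 1 ≤ x := (min_le_iff.mp hx).resolve_left hL.not_ge
    have hA : 1 - p < Real.exp (-x) := by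
      rw [← Real.exp_log (show 0 < 1 - p by linarith)]
      exact Real.exp_lt_exp.mpr (by linarith)
    have hmul' : y * Real.exp (-y) < x * Real.exp (-x) := by
      rw [hE, ← mul_assoc]
      exact mul_lt_mul_of_pos_right (by nlinarith) hy
    have hx2 : (x + 1) * Real.exp (-x) ≤ 1 := by
      calc (x + 1) * Real.exp (-x) ≤ Real.exp x * Real.exp (-x) :=
            mul_le_mul_of_nonneg_right (Real.add_one_le_exp x) (Real.exp_pos _).le
        _ = 1 := by rw [← Real.exp_add, add_neg_cancel, Real.exp_zero]
    rw [max_eq_right (by linarith : 1 - p - Real.exp (-x) ≤ 0)]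
    have hB : max (p - x * Real.exp (-x)) 0 < max (p - y * Real.exp (-y)) 0 :=
      max_lt (lt_max_of_lt_left (by linarith)) (lt_max_of_lt_left (by linarith))
    linarith [le_max_right (1 - p - Real.exp (-y)) 0]
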